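/- arXiv:2510.24587 — 2 statements merged into one kernel-verified Lean document; each statement's English description precedes it below -/
import Mathlib

section
/- Under the hypotheses of the TSS-LogQF variance theorem (κ ≥ 1, ρ = (√(κ+1)−1)/(√(κ+1)+1), Φ ∈ ℝ, reals (s_j) with s₀ = 0 and |s_j − Φ| ≤ 2(√(κ+1)+1) log(2κ) ρ^{2j} for all j ≥ 0, integers 1 ≤ i_min ≤ i_max, pmf p on {i_min,…,i_max}), for every δ > 0 the TSS-LogQF estimator concentrates around s_{i_max}: ∑_{j ∈ {i_min,…,i_max} : |(s_j − s_{j−1})/p(j) + s_{i_min−1} − s_{i_max}| ≥ δ} p(j) ≤ 16 δ^{−2} (√(κ+1)+1)² log²(2κ) Γ, where Γ = ∑_{j=i_min}^{i_max} ρ^{4(j−1)} / p(j). -/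
/-- Chebyshev's inequality for the importance-sampling estimator `d j / p j` of `∑ j, d j`. -/
theorem sum_filter_le_abs_div_sub_sum_le {ι : Type*} (t : Finset ι) (p d : ι → ℝ)
    (hp : ∀ j ∈ t, 0 < p j) (hsum : ∑ j ∈ t, p j = 1) {δ : ℝ} (hδ : 0 < δ) :
    ∑ j ∈ t.filter (fun j => δ ≤ |d j / p j - ∑ i ∈ t, d i|), p j
      ≤ δ⁻¹ ^ 2 * ∑ j ∈ t, d j ^ 2 / p j := by
  set D := ∑ i ∈ t, d i with hD
  have hvar : ∑ j ∈ t, p j * (d j / p j - D) ^ 2 = ∑ j ∈ t, d j ^ 2 / p j - D ^ 2 := by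
    calc ∑ j ∈ t, p j * (d j / p j - D) ^ 2
        = ∑ j ∈ t, (d j ^ 2 / p j - d j * (2 * D) + p j * D ^ 2) := by
          refine Finset.sum_congr rfl fun j hj => ?_
          have := (hp j hj).ne'
          field_simp
          ring
      _ = ∑ j ∈ t, d j ^ 2 / p j - D ^ 2 := by
          rw [Finset.sum_add_distrib, Finset.sum_sub_distrib, ← Finset.sum_mul,
            ← Finset.sum_mul, hsum, ← hD]
          ring
  calc ∑ j ∈ t.filter (fun j => δ ≤ |d j / p j - D|), p j
      ≤ ∑ j ∈ t.filter (fun j => δ ≤ |d j / p j - D|),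
          δ⁻¹ ^ 2 * (p j * (d j / p j - D) ^ 2) := by
        refine Finset.sum_le_sum fun j hj => ?_
        obtain ⟨hjt, hj⟩ := Finset.mem_filter.mp hj
        have hsq : δ ^ 2 ≤ (d j / p j - D) ^ 2 := by
          rw [← sq_abs (d j / p j - D)]
          gcongr
        calc p j = δ⁻¹ ^ 2 * (p j * δ ^ 2) := by field_simp
          _ ≤ δ⁻¹ ^ 2 * (p j * (d j / p j - D) ^ 2) := by
            have := hp j hjt
            gcongr
    _ ≤ ∑ j ∈ t, δ⁻¹ ^ 2 * (p j * (d j / p j - D) ^ 2) :=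
        Finset.sum_le_sum_of_subset_of_nonneg (Finset.filter_subset _ _) fun j hj _ => by
          have := hp j hj
          positivity
    _ ≤ δ⁻¹ ^ 2 * ∑ j ∈ t, d j ^ 2 / p j := by
        rw [← Finset.mul_sum, hvar]
        gcongr
        linarith [sq_nonneg D]

theorem sum_Icc_sub_pred (s : ℕ → ℝ) {m n : ℕ} (hmn : m ≤ n) :
    ∑ j ∈ Finset.Icc m n, (s j - s (j - 1)) = s n - s (m - 1) := by
  induction n, hmn using Nat.le_induction with
  | base => simp
  | succ n hn ih =>
    rw [Finset.sum_Icc_succ_top (by omega), ih]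
    simp

/-- Concentration of the TSS-LogQF estimator around `s_{i_max}`. -/
theorem tss_logqf_concentration
    (κ : ℝ) (hκ : 1 ≤ κ)
    (ρ : ℝ) (hρ : ρ = (Real.sqrt (κ + 1) - 1) / (Real.sqrt (κ + 1) + 1))
    (Φ : ℝ) (s : ℕ → ℝ) (hs0 : s 0 = 0)
    (hbound : ∀ j : ℕ,
      |s j - Φ| ≤ 2 * (Real.sqrt (κ + 1) + 1) * Real.log (2 * κ) * ρ ^ (2 * j))
    (imin imax : ℕ) (h1 : 1 ≤ imin) (h2 : imin ≤ imax)
    (p : ℕ → ℝ)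
    (hp : ∀ j ∈ Finset.Icc imin imax, 0 < p j ∧ p j ≤ 1)
    (hsum : ∑ j ∈ Finset.Icc imin imax, p j = 1)
    (δ : ℝ) (hδ : 0 < δ) :
    ∑ j ∈ (Finset.Icc imin imax).filter
        (fun j => δ ≤ |(s j - s (j - 1)) / p j + s (imin - 1) - s imax|),
      p j
      ≤ 16 * δ⁻¹ ^ 2 * (Real.sqrt (κ + 1) + 1) ^ 2 * Real.log (2 * κ) ^ 2 *
        ∑ j ∈ Finset.Icc imin imax, ρ ^ (4 * (j - 1)) / p j := by
  have hsqrt : 1 ≤ Real.sqrt (κ + 1) := Real.one_le_sqrt.mpr (by linarith)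
  have hρ0 : 0 ≤ ρ := hρ ▸ div_nonneg (by linarith) (by linarith)
  have hρ1 : ρ ≤ 1 := by
    rw [hρ]
    exact div_le_one_of_le₀ (by linarith) (by linarith)
  have hlog : 0 ≤ Real.log (2 * κ) := Real.log_nonneg (by linarith)
  have hinc : ∀ j, (s j - s (j - 1)) ^ 2 ≤
      16 * (Real.sqrt (κ + 1) + 1) ^ 2 * Real.log (2 * κ) ^ 2 * ρ ^ (4 * (j - 1)) := by
    intro j
    set C := 2 * (Real.sqrt (κ + 1) + 1) * Real.log (2 * κ) with hC
    have hC0 : 0 ≤ C := by positivity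
    have hpow : C * ρ ^ (2 * j) ≤ C * ρ ^ (2 * (j - 1)) :=
      mul_le_mul_of_nonneg_left (pow_le_pow_of_le_one hρ0 hρ1 (by omega)) hC0
    have habs : |s j - s (j - 1)| ≤ 2 * C * ρ ^ (2 * (j - 1)) := by
      have := abs_sub_le (s j) Φ (s (j - 1))
      rw [abs_sub_comm Φ] at this
      linarith [hbound j, hbound (j - 1)]
    calc (s j - s (j - 1)) ^ 2 = |s j - s (j - 1)| ^ 2 := (sq_abs _).symm
      _ ≤ (2 * C * ρ ^ (2 * (j - 1))) ^ 2 := by gcongr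
      _ = _ := by
        rw [hC, show 4 * (j - 1) = 2 * (j - 1) * 2 by ring, pow_mul]
        ring
  have hcheb := sum_filter_le_abs_div_sub_sum_le (Finset.Icc imin imax) p
    (fun j => s j - s (j - 1)) (fun j hj => (hp j hj).1) hsum hδ
  simp only [sum_Icc_sub_pred s h2, ← sub_add, sub_add_eq_add_sub] at hcheb
  refine hcheb.trans ?_
  calc δ⁻¹ ^ 2 * ∑ j ∈ Finset.Icc imin imax, (s j - s (j - 1)) ^ 2 / p j
      ≤ δ⁻¹ ^ 2 * ∑ j ∈ Finset.Icc imin imax,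
          16 * (Real.sqrt (κ + 1) + 1) ^ 2 * Real.log (2 * κ) ^ 2 * ρ ^ (4 * (j - 1)) / p j := by
        gcongr with j hj
        · exact (hp j hj).1.le
        · exact hinc j
    _ = _ := by
        simp only [mul_div_assoc, ← Finset.mul_sum]
        ring
end

section
/- Let V be a real inner product space, let x ∈ V, let (x_j)_{j≥0} be a sequence in V with x₀ = 0 satisfying ‖x_j − x‖ ≤ κ · (2ρ^j/(1+ρ^{2j})) · ‖x‖ for all j ≥ 0, where κ > 1 and ρ = (√κ − 1)/(√κ + 1). Let 1 ≤ i₁ < i₂ be integers (i₁ = i_min, i₂ = i_max) and let p be the Γ-optimal distribution p(i) = ρ^i / ∑_{l=i₁}^{i₂} ρ^l on {i₁, …, i₂}. Then the variance of the TSS-Solve estimator satisfies ∑_{j=i₁}^{i₂} p(j) ‖(x_j − x_{j−1})/p(j) + x_{i₁−1} − x_{i₂}‖² ≤ 4 κ² ‖x‖² · ρ^{2(i₁−1)} ( ρ^{i₂−i₁+1} − 1 )² · (√κ + 1)². -/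
/-- The variance of an importance-sampled sum is at most its second moment. -/
theorem sum_weight_mul_norm_inv_smul_sub_sq_le {ι V : Type*} [NormedAddCommGroup V]
    [InnerProductSpace ℝ V] (s : Finset ι) (p : ι → ℝ) (d : ι → V) (hp : ∀ i ∈ s, 0 < p i)
    (hsum : ∑ i ∈ s, p i = 1) :
    ∑ i ∈ s, p i * ‖(p i)⁻¹ • d i - ∑ j ∈ s, d j‖ ^ 2 ≤ ∑ i ∈ s, ‖d i‖ ^ 2 / p i := by
  set D := ∑ j ∈ s, d j with hD
  have hterm : ∀ i ∈ s, p i * ‖(p i)⁻¹ • d i - D‖ ^ 2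
      = ‖d i‖ ^ 2 / p i - 2 * inner ℝ (d i) D + p i * ‖D‖ ^ 2 := by
    intro i hi
    have hpi := (hp i hi).ne'
    rw [norm_sub_sq_real, norm_smul, real_inner_smul_left, mul_pow, Real.norm_eq_abs, sq_abs]
    field_simp
  rw [Finset.sum_congr rfl hterm, Finset.sum_add_distrib, Finset.sum_sub_distrib,
    ← Finset.mul_sum, ← Finset.sum_mul, ← sum_inner, ← hD, hsum, real_inner_self_eq_norm_sq]
  nlinarith [sq_nonneg ‖D‖]

theorem sum_Icc_sub_pred_s14 {V : Type*} [AddCommGroup V] (f : ℕ → V) {a b : ℕ} (h : a ≤ b) :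
    ∑ j ∈ Finset.Icc (a + 1) b, (f j - f (j - 1)) = f b - f a := by
  induction b, h using Nat.le_induction with
  | base => simp
  | succ b hab ih =>
    rw [Finset.sum_Icc_succ_top (by omega), ih]
    simp

/-- Consecutive iterates satisfying the conjugate gradient bound differ by at most a geometric
term. -/
theorem norm_sub_succ_le_of_cg_bound {V : Type*} [NormedAddCommGroup V] (x : V) (xs : ℕ → V)
    {κ ρ : ℝ} (hκ : 0 ≤ κ) (hρ0 : 0 ≤ ρ) (hρ1 : ρ ≤ 1)
    (hbound : ∀ j : ℕ, ‖xs j - x‖ ≤ κ * (2 * ρ ^ j / (1 + ρ ^ (2 * j))) * ‖x‖) (k : ℕ) :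
    ‖xs (k + 1) - xs k‖ ≤ 4 * κ * ‖x‖ * ρ ^ k := by
  have hb : ∀ j, ‖xs j - x‖ ≤ κ * (2 * ρ ^ j) * ‖x‖ := fun j => by
    refine (hbound j).trans ?_
    gcongr
    exact div_le_self (by positivity) (by linarith [pow_nonneg hρ0 (2 * j)])
  have hk : ρ ^ (k + 1) ≤ ρ ^ k := pow_le_pow_of_le_one hρ0 hρ1 k.le_succ
  calc ‖xs (k + 1) - xs k‖ ≤ ‖xs (k + 1) - x‖ + ‖xs k - x‖ := by
        simpa using norm_sub_le (xs (k + 1) - x) (xs k - x)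
    _ ≤ κ * (2 * ρ ^ k) * ‖x‖ + κ * (2 * ρ ^ k) * ‖x‖ := by
        refine add_le_add ((hb _).trans ?_) (hb k)
        gcongr
    _ = 4 * κ * ‖x‖ * ρ ^ k := by ring


/-- Variance bound for the TSS-Solve estimator under the Γ-optimal
sampling distribution. -/
theorem tss_solve_variance_optimal {V : Type*} [NormedAddCommGroup V] [InnerProductSpace ℝ V]
    (x : V) (xs : ℕ → V) (hx0 : xs 0 = 0)
    (κ : ℝ) (hκ : 1 < κ)
    (ρ : ℝ) (hρ : ρ = (Real.sqrt κ - 1) / (Real.sqrt κ + 1))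
    (hbound : ∀ j : ℕ, ‖xs j - x‖ ≤ κ * (2 * ρ ^ j / (1 + ρ ^ (2 * j))) * ‖x‖)
    (i1 i2 : ℕ) (h1 : 1 ≤ i1) (h2 : i1 < i2)
    (p : ℕ → ℝ)
    (hpdef : ∀ i, p i = ρ ^ i / ∑ l ∈ Finset.Icc i1 i2, ρ ^ l) :
    ∑ j ∈ Finset.Icc i1 i2,
        p j * ‖(p j)⁻¹ • (xs j - xs (j - 1)) + xs (i1 - 1) - xs i2‖ ^ 2
      ≤ 4 * κ ^ 2 * ‖x‖ ^ 2 * ρ ^ (2 * (i1 - 1)) * (ρ ^ (i2 - i1 + 1) - 1) ^ 2 *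
        (Real.sqrt κ + 1) ^ 2 := by
  obtain ⟨a, rfl⟩ : ∃ a, i1 = a + 1 := ⟨i1 - 1, by omega⟩
  obtain ⟨n, rfl⟩ : ∃ n, i2 = a + n := ⟨i2 - a, by omega⟩
  have hs : 1 < Real.sqrt κ := by simpa using Real.sqrt_lt_sqrt zero_le_one hκ
  have hs' : 0 < Real.sqrt κ + 1 := by linarith
  have hρ0 : 0 < ρ := by rw [hρ]; exact div_pos (by linarith) hs'
  have hρeq : (Real.sqrt κ + 1) * (1 - ρ) = 2 := by rw [hρ]; field_simp; ring
  have hρ1 : ρ < 1 := by nlinarith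
  set S := ∑ l ∈ Finset.Icc (a + 1) (a + n), ρ ^ l with hS
  have hSpos : 0 < S :=
    Finset.sum_pos (fun _ _ => pow_pos hρ0 _) (Finset.nonempty_Icc.2 h2.le)
  have hp : ∀ i, 0 < p i := fun i => by rw [hpdef]; positivity
  have hsum : ∑ i ∈ Finset.Icc (a + 1) (a + n), p i = 1 := by
    simp_rw [hpdef, ← Finset.sum_div, ← hS]
    exact div_self hSpos.ne'
  have hSeq : 2 * S = ρ * ρ ^ a * (1 - ρ ^ n) * (Real.sqrt κ + 1) := by
    have hgeom : S * (ρ - 1) = ρ ^ (a + n + 1) - ρ ^ (a + 1) := by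
      rw [hS, ← Finset.Ico_add_one_right_eq_Icc, geom_sum_Ico hρ1.ne (by omega),
        div_mul_cancel₀ _ (sub_ne_zero.2 hρ1.ne)]
    calc 2 * S = -(S * (ρ - 1)) * (Real.sqrt κ + 1) := by rw [← hρeq]; ring
      _ = _ := by rw [hgeom]; ring
  have hvar := sum_weight_mul_norm_inv_smul_sub_sq_le (Finset.Icc (a + 1) (a + n)) p
    (fun j => xs j - xs (j - 1)) (fun i _ => hp i) hsum
  rw [sum_Icc_sub_pred_s14 xs (Nat.le_add_right a n)] at hvar
  simp only [sub_sub_eq_add_sub] at hvar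
  have hterm : ∀ j ∈ Finset.Icc (a + 1) (a + n),
      ‖xs j - xs (j - 1)‖ ^ 2 / p j ≤ (4 * κ * ‖x‖ / ρ) ^ 2 * S * ρ ^ j := by
    intro j hj
    obtain ⟨k, rfl⟩ : ∃ k, j = k + 1 := ⟨j - 1, by have := (Finset.mem_Icc.1 hj).1; omega⟩
    have hd := norm_sub_succ_le_of_cg_bound x xs (by linarith) hρ0.le hρ1.le hbound k
    rw [div_le_iff₀ (hp _), hpdef]
    calc ‖xs (k + 1) - xs (k + 1 - 1)‖ ^ 2 ≤ (4 * κ * ‖x‖ * ρ ^ k) ^ 2 := by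
          gcongr
          exact hd
      _ = _ := by field_simp; ring
  calc _ ≤ _ := hvar
    _ ≤ ∑ j ∈ Finset.Icc (a + 1) (a + n), (4 * κ * ‖x‖ / ρ) ^ 2 * S * ρ ^ j :=
        Finset.sum_le_sum hterm
    _ = (2 * κ * ‖x‖ / ρ) ^ 2 * (2 * S) ^ 2 := by rw [← Finset.mul_sum, ← hS]; ring
    _ = _ := by
        rw [hSeq, show a + n - (a + 1) + 1 = n by omega, Nat.add_sub_cancel]
        field_simp
        ring
end
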